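/- For every integer k ≥ 1 and d = 2^{k+1} − 1, there exists a deterministic 1-aware population protocol computing the threshold predicate R_d with at most k + 3 states. -/

import Mathlib

/-- A population protocol `⟨Q, Q₀, Q₁, q_init, δ⟩` over a set of states `Q`. -/
structure PopulationProtocol (Q : Type) where
  Q0 : Set Q
  Q1 : Set Q
  qinit : Q
  delta : Q → Q → Set (Q × Q)
  union_eq : Q0 ∪ Q1 = Set.univ
  inter_eq : Q0 ∩ Q1 = ∅
  delta_nonempty : ∀ q1 q2 : Q, (delta q1 q2).Nonempty

namespace PopulationProtocol

variable {Q : Type} (P : PopulationProtocol Q)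

/-- A protocol is deterministic if every value of `δ` is a singleton. -/
def Deterministic : Prop := ∀ q1 q2 : Q, ∃ p : Q × Q, P.delta q1 q2 = {p}

/-- The initial `n`-size configuration `I_n`: all agents in the initial state. -/
def initConfig (n : ℕ) : Fin n → Q := fun _ => P.qinit

/-- `(C1, C2)` is a transition: two distinct agents interact according to `δ`,
all other agents keep their state. -/
def Transition {n : ℕ} (C1 C2 : Fin n → Q) : Prop :=
  ∃ i j : Fin n, i ≠ j ∧ (C2 i, C2 j) ∈ P.delta (C1 i) (C1 j) ∧
    ∀ k : Fin n, k ≠ i → k ≠ j → C2 k = C1 k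

/-- `D` is reachable from `C` via a finite sequence of transitions. -/
def Reachable {n : ℕ} (C D : Fin n → Q) : Prop :=
  Relation.ReflTransGen P.Transition C D

/-- An execution: an infinite sequence of configurations starting from `I_n`,
each consecutive pair being a transition. -/
def IsExecution {n : ℕ} (E : ℕ → Fin n → Q) : Prop :=
  E 0 = P.initConfig n ∧ ∀ i : ℕ, P.Transition (E i) (E (i + 1))

/-- Fairness: whenever `C` occurs infinitely often and `D` is reachable from `C`,
`D` also occurs infinitely often. -/
def Fair {n : ℕ} (E : ℕ → Fin n → Q) : Prop :=
  ∀ C D : Fin n → Q, (∀ N : ℕ, ∃ i ≥ N, E i = C) → P.Reachable C D →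
    (∀ N : ℕ, ∃ i ≥ N, E i = D)

/-- `Π` is a 1-aware population protocol computing the predicate `R`. -/
def Computes1Aware (R : ℕ → Bool) : Prop :=
  ∀ n : ℕ, 0 < n →
    (R n = false →
      ∀ C : Fin n → Q, P.Reachable (P.initConfig n) C → ∀ i : Fin n, C i ∈ P.Q0) ∧
    (R n = true →
      ∀ E : ℕ → Fin n → Q, P.IsExecution E → P.Fair E →
        ∃ i0 : ℕ, ∀ i ≥ i0, ∀ a : Fin n, E i a ∈ P.Q1)

/-- A state `q` can occur from a configuration `C`. -/
def CanOccur {n : ℕ} (C : Fin n → Q) (q : Q) : Prop :=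
  ∃ D : Fin n → Q, P.Reachable C D ∧ ∃ i : Fin n, D i = q

/-- `f q`: the minimal `n ∈ ℤ⁺` such that `q` can occur from `I_n`
(`⊤` if there is no such `n`). -/
noncomputable def f (q : Q) : ℕ∞ :=
  sInf {m : ℕ∞ | ∃ n : ℕ, m = (n : ℕ∞) ∧ 0 < n ∧ P.CanOccur (P.initConfig n) q}

/-- `f(Q)`: the set of finite values of `f`. -/
def fQ : Set ℕ := {n : ℕ | ∃ q : Q, P.f q = (n : ℕ∞)}

end PopulationProtocol

/-- The threshold predicate `R_d(n) = 1 ↔ n ≥ d`. -/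
def threshold (d : ℕ) : ℕ → Bool := fun n => decide (d ≤ n)

/-- `e(m)`: the number of `1`s in the binary representation of `m`. -/
def onesCount (m : ℕ) : ℕ := (Nat.digits 2 m).count 1

/-- `z(m)`: the number of `0`s in the binary representation of `m`
(no leading zeros). -/
def zerosCount (m : ℕ) : ℕ := (Nat.digits 2 m).count 0

namespace WarmUp

/-- The step function: levels `0..k`, blank `k+1`, accepting `k+2`. -/
def step (k : ℕ) (p q : Fin (k + 3)) : Fin (k + 3) × Fin (k + 3) :=
  if p.val = k + 2 ∨ q.val = k + 2 then (⟨k + 2, by omega⟩, ⟨k + 2, by omega⟩)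
  else if p = q ∧ p.val = k then (⟨k + 2, by omega⟩, ⟨k + 2, by omega⟩)
  else if h : p = q ∧ p.val < k then
    (⟨p.val + 1, by omega⟩, if p.val + 1 = k then ⟨0, by omega⟩ else ⟨k + 1, by omega⟩)
  else (p, q)

def prot (k : ℕ) : PopulationProtocol (Fin (k + 3)) where
  Q0 := {q | q.val ≠ k + 2}
  Q1 := {q | q.val = k + 2}
  qinit := ⟨0, by omega⟩
  delta := fun p q => {step k p q}
  union_eq := by ext q; simp; tauto
  inter_eq := by ext q; simp
  delta_nonempty := fun p q => Set.singleton_nonempty _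

def wt (k x : ℕ) : ℕ := if x < k then 2 ^ x else if x = k then 2 ^ k - 1 else 0

def vt (k x : ℕ) : ℕ := if x < k then 2 else if x = k + 2 then 0 else 1

theorem step_T (k : ℕ) (p q : Fin (k + 3)) (h : p.val = k + 2 ∨ q.val = k + 2) :
    step k p q = (⟨k + 2, by omega⟩, ⟨k + 2, by omega⟩) := by
  simp [step, h]

theorem step_top (k : ℕ) (p q : Fin (k + 3)) (h : p = q) (h2 : p.val = k) :
    step k p q = (⟨k + 2, by omega⟩, ⟨k + 2, by omega⟩) := by
  subst h; simp [step, h2]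

theorem step_cases (k : ℕ) (p q : Fin (k + 3)) (hp : p.val ≠ k + 2) (hq : q.val ≠ k + 2) :
    (p = q ∧ p.val = k) ∨
    (p = q ∧ p.val + 1 = k ∧ (step k p q).1.val = k ∧ (step k p q).2.val = 0) ∨
    (p = q ∧ p.val + 1 < k ∧ (step k p q).1.val = p.val + 1 ∧ (step k p q).2.val = k + 1) ∨
    (step k p q = (p, q)) := by
  by_cases h : p = q
  · subst h
    rcases lt_trichotomy p.val k with h1 | h1 | h1
    · by_cases h2 : p.val + 1 = k
      · right; left
        refine ⟨rfl, h2, ?_, ?_⟩ <;> simp [step, hp, h1, h1.ne, h2]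
      · right; right; left
        refine ⟨rfl, by omega, ?_, ?_⟩ <;> simp [step, hp, h1, h1.ne, h2]
    · left; exact ⟨rfl, h1⟩
    · right; right; right
      have : ¬ p.val < k := by omega
      have h3 : p.val ≠ k := by omega
      simp [step, hp, this, h3]
  · right; right; right
    simp [step, hp, hq, h]

theorem sum_change {n : ℕ} {Q : Type} (f : Q → ℕ) (C D : Fin n → Q) (i j : Fin n) (hij : i ≠ j)
    (h : ∀ l, l ≠ i → l ≠ j → D l = C l) :
    ∑ l, f (D l) + (f (C i) + f (C j)) = ∑ l, f (C l) + (f (D i) + f (D j)) := by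
  have key : ∀ E : Fin n → Q, ∑ l, f (E l) =
      f (E i) + (f (E j) + ∑ l ∈ (Finset.univ.erase i).erase j, f (E l)) := by
    intro E
    rw [Finset.add_sum_erase _ (fun l => f (E l)) (by simp [hij.symm]),
      Finset.add_sum_erase _ (fun l => f (E l)) (by simp)]
  rw [key C, key D]
  have : ∑ l ∈ (Finset.univ.erase i).erase j, f (D l)
      = ∑ l ∈ (Finset.univ.erase i).erase j, f (C l) := by
    apply Finset.sum_congr rfl
    intro l hl
    simp at hl
    rw [h l hl.2 hl.1]
  omega

theorem wt_step (k : ℕ) (p q : Fin (k + 3)) (hp : p.val ≠ k + 2) (hq : q.val ≠ k + 2)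
    (ht : ¬ (p = q ∧ p.val = k)) :
    wt k (step k p q).1 + wt k (step k p q).2 = wt k p + wt k q := by
  rcases step_cases k p q hp hq with h | ⟨h1, h2, h3, h4⟩ | ⟨h1, h2, h3, h4⟩ | h
  · exact absurd h ht
  · subst h1
    rw [h3, h4]
    have h5 : p.val < k := by omega
    have h6 : 0 < k := by omega
    have h7 : 2 ^ k = 2 ^ p.val * 2 := by rw [← pow_succ, h2]
    have : 0 < 2 ^ p.val := by positivity
    simp [wt, h5, h6]; omega
  · subst h1
    rw [h3, h4]
    have h5 : p.val < k := by omega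
    simp [wt, pow_succ, h2, h5]; omega
  · rw [h]

theorem step_T_iff (k : ℕ) (p q : Fin (k + 3)) (hp : p.val ≠ k + 2) (hq : q.val ≠ k + 2)
    (ht : ¬ (p = q ∧ p.val = k)) :
    (step k p q).1.val ≠ k + 2 ∧ (step k p q).2.val ≠ k + 2 := by
  rcases step_cases k p q hp hq with h | ⟨h1, h2, h3, h4⟩ | ⟨h1, h2, h3, h4⟩ | h
  · exact absurd h ht
  · omega
  · omega
  · rw [h]; exact ⟨hp, hq⟩

/-- General invariant: some agent accepts, or the weight is `n`. -/
def Inv (k : ℕ) {n : ℕ} (C : Fin n → Fin (k + 3)) : Prop :=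
  (∃ i, (C i).val = k + 2) ∨ ∑ i, wt k (C i) = n

theorem trans_iff (k : ℕ) {n : ℕ} (C D : Fin n → Fin (k + 3)) :
    (prot k).Transition C D ↔ ∃ i j : Fin n, i ≠ j ∧ (D i, D j) = step k (C i) (C j) ∧
      ∀ l, l ≠ i → l ≠ j → D l = C l := by
  simp [PopulationProtocol.Transition, prot]

/-- States of a transition into accepting agents persist. -/
theorem T_persist (k : ℕ) {n : ℕ} (C D : Fin n → Fin (k + 3)) (h : (prot k).Transition C D)
    (a : Fin n) (ha : (C a).val = k + 2) : (D a).val = k + 2 := by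
  obtain ⟨i, j, hij, hs, ho⟩ := (trans_iff k C D).1 h
  by_cases h1 : a = i
  · subst h1
    rw [step_T k _ _ (Or.inl ha)] at hs
    exact congrArg (fun x => (Prod.fst x).val) hs
  · by_cases h2 : a = j
    · subst h2
      rw [step_T k _ _ (Or.inr ha)] at hs
      exact congrArg (fun x => (Prod.snd x).val) hs
    · rw [ho a h1 h2]; exact ha

theorem Inv_step (k : ℕ) {n : ℕ} (C D : Fin n → Fin (k + 3)) (h : (prot k).Transition C D)
    (hC : Inv k C) : Inv k D := by
  rcases hC with ⟨a, ha⟩ | hC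
  · exact Or.inl ⟨a, T_persist k C D h a ha⟩
  obtain ⟨i, j, hij, hs, ho⟩ := (trans_iff k C D).1 h
  have hD1 : D i = (step k (C i) (C j)).1 := congrArg Prod.fst hs
  have hD2 : D j = (step k (C i) (C j)).2 := congrArg Prod.snd hs
  by_cases hi : (C i).val = k + 2
  · exact Or.inl ⟨i, T_persist k C D h i hi⟩
  by_cases hj : (C j).val = k + 2
  · exact Or.inl ⟨j, T_persist k C D h j hj⟩
  by_cases ht : C i = C j ∧ (C i).val = k
  · left; refine ⟨i, ?_⟩
    rw [hD1, step_top k _ _ ht.1 ht.2]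
  right
  have := wt_step k _ _ hi hj ht
  have h2 := sum_change (fun q : Fin (k + 3) => wt k q) C D i j hij ho
  rw [← hD1, ← hD2] at this
  omega

theorem Inv_init (k : ℕ) (hk : 1 ≤ k) (n : ℕ) : Inv k ((prot k).initConfig n) := by
  right
  have : 0 < k := hk
  simp [PopulationProtocol.initConfig, prot, wt, this]

/-- Safety invariant. -/
def Safe (k : ℕ) {n : ℕ} (C : Fin n → Fin (k + 3)) : Prop :=
  (∀ i, (C i).val ≠ k + 2) ∧ ∑ i, wt k (C i) = n ∧
    ∀ i j, i ≠ j → (C i).val = k → (C j).val = k → False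

theorem three_le {n : ℕ} (g : Fin n → ℕ) (a b c : Fin n) (h1 : a ≠ b) (h2 : a ≠ c) (h3 : b ≠ c) :
    g a + g b + g c ≤ ∑ l, g l := by
  have : ∑ l ∈ ({a, b, c} : Finset (Fin n)), g l ≤ ∑ l, g l :=
    Finset.sum_le_sum_of_subset (Finset.subset_univ _)
  rw [Finset.sum_insert (by simp [h1, h2]), Finset.sum_insert (by simp [h3]),
    Finset.sum_singleton] at this
  omega

theorem Safe_step (k : ℕ) (hk : 1 ≤ k) {n : ℕ} (hn : n < 2 ^ (k + 1) - 1)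
    (C D : Fin n → Fin (k + 3)) (h : (prot k).Transition C D)
    (hC : Safe k C) : Safe k D := by
  obtain ⟨hT, hS, hU⟩ := hC
  have hInv := Inv_step k C D h (Or.inr hS)
  obtain ⟨i, j, hij, hs, ho⟩ := (trans_iff k C D).1 h
  have hD1 : D i = (step k (C i) (C j)).1 := congrArg Prod.fst hs
  have hD2 : D j = (step k (C i) (C j)).2 := congrArg Prod.snd hs
  have ht : ¬ (C i = C j ∧ (C i).val = k) := fun ht => hU i j hij ht.2 (ht.1 ▸ ht.2)
  have hDT : ∀ l, (D l).val ≠ k + 2 := by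
    have := step_T_iff k _ _ (hT i) (hT j) ht
    intro l
    by_cases h1 : l = i
    · rw [h1, hD1]; exact this.1
    by_cases h2 : l = j
    · rw [h2, hD2]; exact this.2
    rw [ho l h1 h2]; exact hT l
  refine ⟨hDT, ?_, ?_⟩
  · rcases hInv with ⟨a, ha⟩ | h
    · exact absurd ha (hDT a)
    · exact h
  rcases step_cases k _ _ (hT i) (hT j) with h | ⟨h1, h2, h3, h4⟩ | ⟨h1, h2, h3, h4⟩ | h
  · exact absurd h ht
  · have hno : ∀ l, (C l).val = k → False := by
      intro l hl
      have hli : i ≠ l := by rintro rfl; omega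
      have hlj : j ≠ l := by rintro rfl; rw [h1] at h2; omega
      have h5 := three_le (fun l => wt k (C l)) i j l hij hli hlj
      have e1 : wt k (C l) = 2 ^ k - 1 := by simp [wt, hl]
      have e2 : wt k (C i) + wt k (C i) = 2 ^ k := by
        have : (C i).val < k := by omega
        simp only [wt, this, if_true]
        conv_rhs => rw [← h2, pow_succ]
        omega
      simp only [← h1] at h5
      rw [pow_succ] at hn
      have : 0 < 2 ^ k := by positivity
      omega
    have hi : ∀ l, (D l).val = k → l = i := by
      intro l hl
      by_contra hli
      by_cases hlj : l = j
      · rw [hlj, hD2, h4] at hl; omega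
      · rw [ho l hli hlj] at hl; exact hno l hl
    intro a b hab ha hb
    exact hab ((hi a ha).trans (hi b hb).symm)
  all_goals
    have hk : ∀ l, (D l).val = k → (C l).val = k := by
      intro l hl
      by_cases hli : l = i
      · subst hli
        rw [hD1] at hl
        first
          | omega
          | (rw [h] at hl; exact hl)
      by_cases hlj : l = j
      · subst hlj
        rw [hD2] at hl
        first
          | omega
          | (rw [h] at hl; exact hl)
      rwa [← ho l hli hlj]
    exact fun a b hab ha hb => hU a b hab (hk a ha) (hk b hb)

theorem sum_wt (k : ℕ) : ∑ q : Fin (k + 3), wt k q = 2 ^ (k + 1) - 2 := by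
  rw [Fin.sum_univ_eq_sum_range (fun x => wt k x) (k + 3), Finset.sum_range_succ,
    Finset.sum_range_succ, Finset.sum_range_succ]
  have : ∑ x ∈ Finset.range k, wt k x = ∑ x ∈ Finset.range k, 2 ^ x :=
    Finset.sum_congr rfl (fun x hx => by simp [wt, Finset.mem_range.1 hx])
  rw [this, Nat.geomSum_eq (le_refl 2)]
  simp [wt, pow_succ]
  omega

theorem exists_pair (k : ℕ) {n : ℕ} (C : Fin n → Fin (k + 3)) (hn : 2 ^ (k + 1) - 1 ≤ n)
    (hS : ∑ i, wt k (C i) = n) : ∃ i j, i ≠ j ∧ C i = C j ∧ (C i).val ≤ k := by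
  by_contra hc
  push Not at hc
  have h1 : ∑ i, wt k (C i) ≤ ∑ q : Fin (k + 3), wt k q := by
    rw [← Finset.sum_fiberwise Finset.univ C (fun i => wt k (C i))]
    apply Finset.sum_le_sum
    intro q _
    have h2 : ∑ i with C i = q, wt k (C i) = ∑ i with C i = q, wt k q :=
      Finset.sum_congr rfl (fun i hi => by simp at hi; rw [hi])
    rw [h2, Finset.sum_const, smul_eq_mul]
    by_cases hq : q.val ≤ k
    · have : (Finset.univ.filter (fun i => C i = q)).card ≤ 1 := by
        rw [Finset.card_le_one]
        intro a ha b hb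
        simp at ha hb
        by_contra hab
        have := hc a b hab (ha.trans hb.symm)
        rw [ha] at this
        omega
      nlinarith
    · have a1 : ¬ q.val < k := by omega
      have a2 : q.val ≠ k := by omega
      simp [wt, a1, a2]
  rw [sum_wt] at h1
  have : 2 ≤ 2 ^ (k + 1) := by rw [pow_succ]; have : 0 < 2 ^ k := by positivity
                               omega
  omega

theorem exists_trans (k : ℕ) {n : ℕ} (C : Fin n → Fin (k + 3)) (i j : Fin n) (hij : i ≠ j) :
    ∃ D, (prot k).Transition C D ∧
      ∑ l, vt k (D l) + (vt k (C i) + vt k (C j)) = ∑ l, vt k (C l) +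
        (vt k (step k (C i) (C j)).1 + vt k (step k (C i) (C j)).2) := by
  set s := step k (C i) (C j) with hs
  have e1 : Function.update (Function.update C i s.1) j s.2 i = s.1 := by simp [hij]
  have e2 : Function.update (Function.update C i s.1) j s.2 j = s.2 := by simp
  have e3 : ∀ l, l ≠ i → l ≠ j → Function.update (Function.update C i s.1) j s.2 l = C l := by
    intro l h1 h2; simp [h1, h2]
  refine ⟨Function.update (Function.update C i s.1) j s.2, (trans_iff k _ _).2
    ⟨i, j, hij, by rw [e1, e2], e3⟩, ?_⟩
  have := sum_change (fun q : Fin (k + 3) => vt k q) C _ i j hij e3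
  simp only [e1, e2] at this
  exact this

theorem progress (k : ℕ) {n : ℕ} (C : Fin n → Fin (k + 3)) (hn : 2 ^ (k + 1) - 1 ≤ n)
    (hI : Inv k C) (hne : ∃ a, (C a).val ≠ k + 2) :
    ∃ D, (prot k).Transition C D ∧ ∑ l, vt k (D l) < ∑ l, vt k (C l) := by
  have vT : vt k (k + 2) = 0 := by simp [vt]
  have vpos : ∀ x, x ≠ k + 2 → 0 < vt k x := by
    intro x hx; unfold vt; split_ifs <;> omega
  by_cases hT : ∃ i, (C i).val = k + 2
  · obtain ⟨i, hi⟩ := hT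
    obtain ⟨a, ha⟩ := hne
    have hia : i ≠ a := by rintro rfl; exact ha hi
    obtain ⟨D, hD, hv⟩ := exists_trans k C i a hia
    refine ⟨D, hD, ?_⟩
    rw [step_T k _ _ (Or.inl hi)] at hv
    simp only [vT] at hv
    have := vpos _ ha
    omega
  · have hS : ∑ i, wt k (C i) = n := hI.resolve_left hT
    push Not at hT
    obtain ⟨i, j, hij, hc, hle⟩ := exists_pair k C hn hS
    obtain ⟨D, hD, hv⟩ := exists_trans k C i j hij
    refine ⟨D, hD, ?_⟩
    rcases eq_or_lt_of_le hle with h | h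
    · rw [step_top k _ _ hc h] at hv
      simp only [vT] at hv
      have := vpos _ (hT i)
      omega
    · have v2 : vt k (C i) = 2 := by simp [vt, h]
      rw [← hc, v2] at hv
      rcases step_cases k (C i) (C i) (hT i) (hT i) with g | ⟨h1, h2, h3, h4⟩ | ⟨h1, h2, h3, h4⟩ | g
      · omega
      · rw [h3, h4] at hv
        have : 0 < k := by omega
        simp [vt, this] at hv ⊢
        omega
      · rw [h3, h4] at hv
        simp [vt, h2] at hv ⊢
        omega
      · exfalso
        have := congrArg (fun x => x.1.val) g
        have h5 : (C i).val ≠ k + 2 := hT i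
        simp [step, h5, h, h.ne] at this

theorem reach_all (k : ℕ) {n : ℕ} (hn : 2 ^ (k + 1) - 1 ≤ n) (m : ℕ) :
    ∀ C : Fin n → Fin (k + 3), ∑ l, vt k (C l) ≤ m → Inv k C →
      ∃ D, (prot k).Reachable C D ∧ ∀ a, (D a).val = k + 2 := by
  induction m with
  | zero =>
    intro C hm hI
    by_cases hne : ∃ a, (C a).val ≠ k + 2
    · obtain ⟨D, _, hD⟩ := progress k C hn hI hne
      omega
    · push Not at hne
      exact ⟨C, Relation.ReflTransGen.refl, hne⟩
  | succ m ih =>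
    intro C hm hI
    by_cases hne : ∃ a, (C a).val ≠ k + 2
    · obtain ⟨D, hCD, hD⟩ := progress k C hn hI hne
      obtain ⟨F, hF, hF2⟩ := ih D (by omega) (Inv_step k C D hCD hI)
      exact ⟨F, Relation.ReflTransGen.head hCD hF, hF2⟩
    · push Not at hne
      exact ⟨C, Relation.ReflTransGen.refl, hne⟩

theorem inf_often {α : Type} [Finite α] (E : ℕ → α) : ∃ c, ∀ N : ℕ, ∃ i ≥ N, E i = c := by
  obtain ⟨c, hc⟩ := Finite.exists_infinite_fiber E
  refine ⟨c, fun N => ?_⟩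
  have := Set.infinite_coe_iff.1 hc
  obtain ⟨i, hi, hN⟩ := this.exists_gt N
  exact ⟨i, hN.le, hi⟩

end WarmUp

open WarmUp in
theorem upper_bound_warmup (k : ℕ) (hk : 1 ≤ k) :
    ∃ (Q : Type) (inst : Fintype Q) (P : PopulationProtocol Q),
      P.Deterministic ∧ P.Computes1Aware (threshold (2 ^ (k + 1) - 1)) ∧
      @Fintype.card Q inst ≤ k + 3 := by
  refine ⟨Fin (k + 3), inferInstance, prot k, fun p q => ⟨step k p q, rfl⟩, ?_, by simp⟩
  intro n hn
  constructor
  · intro hR C hC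
    have hlt : n < 2 ^ (k + 1) - 1 := by
      simpa only [threshold, decide_eq_false_iff_not, not_le] using hR
    have : Safe k C := by
      induction hC with
      | refl =>
        have h0 : 0 < k := hk
        refine ⟨fun i => ?_, ?_, fun i j _ h => ?_⟩
        · simp [PopulationProtocol.initConfig, prot]
        · simp [PopulationProtocol.initConfig, prot, wt, h0]
        · simp [PopulationProtocol.initConfig, prot] at h
          omega
      | tail _ h ih => exact Safe_step k hk hlt _ _ h ih
    exact this.1
  · intro hR E hE hF
    have hle : 2 ^ (k + 1) - 1 ≤ n := by
      simpa [threshold] using hR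
    have hI : ∀ i, Inv k (E i) := by
      intro i
      induction i with
      | zero => rw [hE.1]; exact Inv_init k hk n
      | succ i ih => exact Inv_step k _ _ (hE.2 i) ih
    obtain ⟨c, hc⟩ := inf_often E
    have hIc : Inv k c := by
      obtain ⟨i, _, hi⟩ := hc 0
      exact hi ▸ hI i
    obtain ⟨D, hD, hDT⟩ := reach_all k hle _ c le_rfl hIc
    obtain ⟨i0, _, hi0⟩ := hF c D hc hD 0
    refine ⟨i0, fun i hi a => ?_⟩
    change (E i a).val = k + 2
    induction i, hi using Nat.le_induction with
    | base => rw [hi0]; exact hDT a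
    | succ i _ ih => exact T_persist k _ _ (hE.2 i) a ih
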